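/- Property q₄ (factorization of the Riemann zeta function over the rays): for every real s > 1, ζ(s) = ∏_{m ∈ M̄} ∏_{n=1}^∞ (1 − pⁿ(m)^{−s})^{−1}, where ζ is the Riemann zeta function and both the inner products and the outer product converge (are multipliable). -/

import Mathlib

/-- `p n` is the `n`-th prime number, indexed from 1: `p 1 = 2`, `p 2 = 3`, `p 3 = 5`, … -/
noncomputable def p (n : ℕ) : ℕ := Nat.nth Nat.Prime (n - 1)

lemma p_prime (n : ℕ) : (p n).Prime := Nat.prime_nth_prime _

lemma lt_p {n : ℕ} (hn : 1 ≤ n) : n < p n := by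
  have := Nat.add_two_le_nth_prime (n - 1)
  unfold p
  omega

lemma p_injOn : Set.InjOn p {n | 1 ≤ n} := by
  intro a ha b hb h
  have := Nat.nth_injective Nat.infinite_setOfPred_prime h
  simp only [Set.mem_ofPred_eq] at ha hb
  omega

lemma exists_p_eq {q : ℕ} (hq : q.Prime) : ∃ k, 1 ≤ k ∧ p k = q :=
  ⟨Nat.count Nat.Prime q + 1, by omega, Nat.nth_count hq⟩

lemma p_iterate_succ_prime (n m : ℕ) : (p^[n + 1] m).Prime := by
  rw [Function.iterate_succ_apply']
  exact p_prime _

lemma one_le_p_iterate {m : ℕ} (hm : 1 ≤ m) : ∀ n, 1 ≤ p^[n] m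
  | 0 => hm
  | n + 1 => (p_iterate_succ_prime n m).one_le

lemma p_iterate_inj {m m' : ℕ} (hm : 1 ≤ m ∧ ¬ m.Prime) (hm' : 1 ≤ m' ∧ ¬ m'.Prime) :
    ∀ {a b : ℕ}, p^[a] m = p^[b] m' → m = m' ∧ a = b
  | 0, 0, h => ⟨h, rfl⟩
  | 0, b + 1, h => (hm.2 (h ▸ p_iterate_succ_prime b m' : Nat.Prime (p^[0] m))).elim
  | a + 1, 0, h => (hm'.2 (h ▸ p_iterate_succ_prime a m : Nat.Prime (p^[0] m'))).elim
  | a + 1, b + 1, h => by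
    rw [Function.iterate_succ_apply', Function.iterate_succ_apply'] at h
    have := p_iterate_inj hm hm' (p_injOn (one_le_p_iterate hm.1 a) (one_le_p_iterate hm'.1 b) h)
    exact ⟨this.1, by rw [this.2]⟩

lemma exists_p_iterate_eq (q : ℕ) (hq : q.Prime) :
    ∃ m, (1 ≤ m ∧ ¬ m.Prime) ∧ ∃ n, p^[n + 1] m = q := by
  induction q using Nat.strong_induction_on with
  | _ q ih =>
    obtain ⟨k, hk, rfl⟩ := exists_p_eq hq
    by_cases hkp : k.Prime
    · obtain ⟨m, hm, n, rfl⟩ := ih k (lt_p hk) hkp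
      exact ⟨m, hm, n + 1, Function.iterate_succ_apply' _ _ _⟩
    · exact ⟨k, ⟨hk, hkp⟩, 0, rfl⟩

/-- Every prime lies on exactly one ray `p m, p (p m), …` with `m` positive and not prime. -/
noncomputable def rayEquiv :
    (Σ _ : {m : ℕ // 1 ≤ m ∧ ¬ m.Prime}, ℕ) ≃ Nat.Primes :=
  Equiv.ofBijective (fun x => ⟨p^[x.2 + 1] (x.1 : ℕ), p_iterate_succ_prime _ _⟩) <| by
    constructor
    · rintro ⟨⟨m, hm⟩, a⟩ ⟨⟨m', hm'⟩, b⟩ h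
      obtain ⟨rfl, hab⟩ := p_iterate_inj hm hm' (congrArg Subtype.val h)
      obtain rfl : a = b := Nat.succ_injective hab
      rfl
    · rintro ⟨q, hq⟩
      obtain ⟨m, hm, n, rfl⟩ := exists_p_iterate_eq q hq
      exact ⟨⟨⟨m, hm⟩, n⟩, rfl⟩

lemma summable_eulerFactor_sub_one {s : ℝ} (hs : 1 < s) :
    Summable fun q : Nat.Primes => (1 - ((q : ℕ) : ℂ) ^ (-(s : ℂ)))⁻¹ - 1 := by
  have hsum : Summable fun q : Nat.Primes => 2 * ((q : ℕ) : ℝ) ^ (-s) :=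
    (Nat.Primes.summable_rpow.2 (by linarith)).mul_left 2
  refine Summable.of_norm_bounded hsum fun q => ?_
  set z : ℂ := ((q : ℕ) : ℂ) ^ (-(s : ℂ)) with hz
  have hnorm : ‖z‖ = ((q : ℕ) : ℝ) ^ (-s) := by
    rw [hz, Complex.norm_natCast_cpow_of_pos q.2.pos]
    simp
  have hq : (2 : ℝ) ≤ ((q : ℕ) : ℝ) := by exact_mod_cast q.2.two_le
  have hhalf : ‖z‖ ≤ 1 / 2 := by
    calc ‖z‖ = ((q : ℕ) : ℝ) ^ (-s) := hnorm
      _ ≤ ((q : ℕ) : ℝ) ^ (-1 : ℝ) :=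
        Real.rpow_le_rpow_of_exponent_le (by linarith) (by linarith)
      _ = ((q : ℕ) : ℝ)⁻¹ := Real.rpow_neg_one _
      _ ≤ 1 / 2 := by rw [one_div]; gcongr
  have hlow : 1 / 2 ≤ ‖1 - z‖ := by
    have := norm_sub_norm_le (1 : ℂ) z
    rw [norm_one] at this
    linarith
  have hne : 1 - z ≠ 0 := norm_pos_iff.1 (by linarith)
  have heq : (1 - z)⁻¹ - 1 = z / (1 - z) := by field_simp; ring
  rw [heq, norm_div, ← hnorm, div_le_iff₀ (by linarith)]
  nlinarith [norm_nonneg z]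

lemma multipliable_ray {s : ℝ} (hs : 1 < s) (m : {m : ℕ // 1 ≤ m ∧ ¬ m.Prime}) :
    Multipliable (fun n : ℕ => (1 - ((p^[n + 1] (m : ℕ) : ℕ) : ℂ) ^ (-(s : ℂ)))⁻¹) := by
  have hinj : Function.Injective fun n : ℕ => rayEquiv ⟨m, n⟩ :=
    rayEquiv.injective.comp sigma_mk_injective
  refine (Complex.multipliable_one_add_of_summable
    ((summable_eulerFactor_sub_one hs).comp_injective hinj)).congr fun n => ?_
  exact add_sub_cancel _ _

/-- **Property q₄ (factorization of the Riemann zeta function over the rays).**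
For every real `s > 1`,
`ζ(s) = ∏_{m ∈ M̄} ∏_{n ≥ 1} (1 - p^[n] m ^ (-s))⁻¹`, where `M̄ = {m | 1 ≤ m ∧ ¬ m.Prime}`,
and both the inner products and the outer product converge (are multipliable). -/
theorem zeta_ray_factorization (s : ℝ) (hs : 1 < s) :
    (∀ m : {m : ℕ // 1 ≤ m ∧ ¬ m.Prime},
        Multipliable (fun n : ℕ => (1 - ((p^[n + 1] (m : ℕ) : ℕ) : ℂ) ^ (-(s : ℂ)))⁻¹)) ∧
    Multipliable (fun m : {m : ℕ // 1 ≤ m ∧ ¬ m.Prime} =>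
        ∏' n : ℕ, (1 - ((p^[n + 1] (m : ℕ) : ℕ) : ℂ) ^ (-(s : ℂ)))⁻¹) ∧
    riemannZeta s =
      ∏' m : {m : ℕ // 1 ≤ m ∧ ¬ m.Prime},
        ∏' n : ℕ, (1 - ((p^[n + 1] (m : ℕ) : ℕ) : ℂ) ^ (-(s : ℂ)))⁻¹ := by
  have hzeta := riemannZeta_eulerProduct_hasProd (s := (s : ℂ)) (by simpa using hs)
  have houter := (rayEquiv.hasProd_iff.2 hzeta).sigma fun m => (multipliable_ray hs m).hasProd
  exact ⟨multipliable_ray hs, houter.multipliable, houter.tprod_eq.symm⟩
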